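/- Let (a,b,c) ∈ ℝ³ be an admissible triple (at most one of a, b, c is zero) satisfying a² + b² + c² − 2abc > 1 and |a| ≤ 1, |b| ≤ 1, |c| ≤ 1. Then there exists γ ∈ Γ₂ such that at least one coordinate of γ(a,b,c) has absolute value greater than 1. -/

import Mathlib

open Real

noncomputable section

/-- `σ₁(x,y,z) = (z, y, 2yz − x)` as a bijection of `ℝ³`. -/
def sigma1 : Equiv.Perm (ℝ × ℝ × ℝ) where
  toFun p := (p.2.2, p.2.1, 2 * p.2.1 * p.2.2 - p.1)
  invFun p := (2 * p.2.1 * p.1 - p.2.2, p.2.1, p.1)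
  left_inv := by rintro ⟨x, y, z⟩; simp [Prod.ext_iff]
  right_inv := by rintro ⟨x, y, z⟩; simp [Prod.ext_iff]

/-- `σ₂(x,y,z) = (x, 2xy − z, y)` as a bijection of `ℝ³`. -/
def sigma2 : Equiv.Perm (ℝ × ℝ × ℝ) where
  toFun p := (p.1, 2 * p.1 * p.2.1 - p.2.2, p.2.1)
  invFun p := (p.1, p.2.2, 2 * p.1 * p.2.2 - p.2.1)
  left_inv := by rintro ⟨x, y, z⟩; simp [Prod.ext_iff]
  right_inv := by rintro ⟨x, y, z⟩; simp [Prod.ext_iff]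

/-- `Γ₂` is the group of bijections of `ℝ³` generated by `σ₁` and `σ₂`. -/
def Gamma2 : Subgroup (Equiv.Perm (ℝ × ℝ × ℝ)) := Subgroup.closure {sigma1, sigma2}

/-- The three-term recurrence is determined by two initial values. -/
lemma rec_unique (x : ℝ) (f g : ℤ → ℝ) (hf : ∀ n, f (n+1) = 2 * x * f n - f (n-1))
    (hg : ∀ n, g (n+1) = 2 * x * g n - g (n-1)) (h0 : f 0 = g 0) (h1 : f 1 = g 1) :
    ∀ n, f n = g n := by
  have key : ∀ n : ℤ, f n = g n ∧ f (n+1) = g (n+1) := by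
    intro n
    induction n using Int.induction_on with
    | zero => exact ⟨h0, by simpa using h1⟩
    | succ i ih =>
      refine ⟨ih.2, ?_⟩
      have a := hf (i+1)
      have b := hg (i+1)
      simp only [add_sub_cancel_right] at a b
      rw [a, b, ih.1, ih.2]
    | pred i ih =>
      have e : (-(i:ℤ) - 1 + 1) = -i := by ring
      refine ⟨?_, by rw [e]; exact ih.1⟩
      have a := hf (-i)
      have b := hg (-i)
      rw [ih.1, ih.2] at a
      linarith
  exact fun n => (key n).1

/-- Growth along an orbit of an elliptic element, nonnegative trace. -/
lemma seq_growth_pos (x E : ℝ) (f : ℤ → ℝ) (hf : ∀ n, f (n+1) = 2 * x * f n - f (n-1))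
    (hx0 : 0 ≤ x) (hx1 : x ≤ 1) (hE : 1 < E) (hb : ∀ n, |f n| ≤ 1)
    (hQ : f 0 ^ 2 + f 1 ^ 2 - 2 * x * f 0 * f 1 = E - x ^ 2) :
    ∃ n, E * x ^ 2 ≤ f n ^ 2 := by
  rcases hx1.eq_or_lt with rfl | hx1
  · exfalso
    have hlin := rec_unique 1 f (fun n => f 0 + n * (f 1 - f 0)) hf
      (fun n => by push_cast; ring) (by simp) (by simp)
    have hd : 0 < |f 1 - f 0| := by
      rw [abs_pos]
      intro h
      have : f 1 = f 0 := by linarith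
      rw [this] at hQ
      nlinarith
    obtain ⟨N, hN⟩ := exists_nat_gt (2 / |f 1 - f 0|)
    rw [div_lt_iff₀ hd] at hN
    have h1 := hb N
    have h0 := hb 0
    have e : (N:ℝ) * (f 1 - f 0) = f N - f 0 := by rw [hlin N]; simp
    have : |(N:ℝ) * (f 1 - f 0)| ≤ 2 := by
      rw [e]; exact (abs_sub _ _).trans (by linarith)
    rw [abs_mul, Nat.abs_cast] at this
    linarith
  · set θ := arccos x with hθ
    have hc : cos θ = x := cos_arccos (by linarith) hx1.le
    have hθ0 : 0 < θ := arccos_pos.2 hx1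
    have hθ1 : θ ≤ π / 2 := arccos_le_pi_div_two.2 hx0
    have hs : 0 < sin θ := sin_pos_of_pos_of_lt_pi hθ0 (by linarith [pi_pos])
    have hsc : sin θ ^ 2 = 1 - x ^ 2 := by rw [sin_sq, hc]
    let w : ℂ := ⟨f 0, -((f 1 - x * f 0) / sin θ)⟩
    set R := ‖w‖
    set φ := w.arg
    have hre : f 0 = R * cos φ := (Complex.norm_mul_cos_arg w).symm
    have him : -((f 1 - x * f 0) / sin θ) = R * sin φ := (Complex.norm_mul_sin_arg w).symm
    have him' : f 1 = x * f 0 - R * sin φ * sin θ := by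
      rw [← him]; field_simp; ring
    have hfn := rec_unique x f (fun n => R * cos (φ + n * θ)) hf
      (fun n => by
        have e1 : φ + ((n+1 : ℤ):ℝ) * θ = (φ + n * θ) + θ := by push_cast; ring
        have e2 : φ + ((n-1 : ℤ):ℝ) * θ = (φ + n * θ) - θ := by push_cast; ring
        simp only [e1, e2, cos_add (φ + n * θ) θ, cos_sub, hc]; ring)
      (by simpa using hre)
      (by simp only [Int.cast_one, one_mul, cos_add, hc]; rw [him', hre]; ring)
    have hR : E ≤ R ^ 2 := by
      have : R ^ 2 * sin θ ^ 2 = E - x ^ 2 := by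
        rw [← hQ, him', hre]
        linear_combination (R^2 * cos φ^2) * hsc + (R^2 * sin θ ^2) * (-(sin_sq_add_cos_sq φ)) 
      rw [hsc] at this
      have h1 : 0 < 1 - x ^ 2 := by nlinarith
      have : E * (1 - x^2) ≤ R^2 * (1 - x^2) := by nlinarith
      exact le_of_mul_le_mul_right this h1
    refine ⟨-round (φ / θ), ?_⟩
    rw [hfn]
    have hδ : |φ + ((-round (φ / θ) : ℤ) : ℝ) * θ| ≤ θ := by
      have h := abs_sub_round (φ / θ)
      have e : φ + ((-round (φ / θ) : ℤ) : ℝ) * θ = (φ / θ - round (φ / θ)) * θ := by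
        push_cast; field_simp; ring
      rw [e, abs_mul, abs_of_pos hθ0]
      nlinarith
    have hcos : x ≤ cos (φ + ((-round (φ / θ) : ℤ) : ℝ) * θ) := by
      rw [← cos_abs, ← hc]
      exact cos_le_cos_of_nonneg_of_le_pi (abs_nonneg _) (by linarith [pi_pos]) hδ
    show E * x ^ 2 ≤ (R * _) ^ 2
    rw [mul_pow]
    gcongr

lemma seq_growth (x E : ℝ) (f : ℤ → ℝ) (hf : ∀ n, f (n+1) = 2 * x * f n - f (n-1))
    (hx : |x| ≤ 1) (hE : 1 < E) (hb : ∀ n, |f n| ≤ 1)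
    (hQ : f 0 ^ 2 + f 1 ^ 2 - 2 * x * f 0 * f 1 = E - x ^ 2) :
    ∃ n, E * x ^ 2 ≤ f n ^ 2 := by
  rw [abs_le] at hx
  rcases le_total 0 x with h | h
  · exact seq_growth_pos x E f hf h hx.2 hE hb hQ
  · have hm : ∀ n : ℤ, ((-1:ℝ) ^ n) ^ 2 = 1 := by
      intro n
      rcases Int.even_or_odd n with h | h
      · simp [h.neg_one_zpow]
      · simp [h.neg_one_zpow]
    obtain ⟨n, hn⟩ := seq_growth_pos (-x) E (fun n => (-1:ℝ)^n * f n)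
      (fun n => by
        have e1 : (-1:ℝ)^(n+1) = -(-1:ℝ)^n := by rw [zpow_add₀ (by norm_num)]; simp
        have e2 : (-1:ℝ)^(n-1) = -(-1:ℝ)^n := by
          rw [zpow_sub₀ (by norm_num), zpow_one]; ring
        simp only [e1, e2, hf n]; ring)
      (by linarith) (by linarith) hE
      (fun n => by simpa [abs_mul, abs_zpow] using hb n)
      (by simp only [zpow_zero, zpow_one]; linarith)
    refine ⟨n, ?_⟩
    simp only [mul_pow, hm, one_mul] at hn
    simpa using hn

def EE (p : ℝ × ℝ × ℝ) : ℝ := p.1 ^ 2 + p.2.1 ^ 2 + p.2.2 ^ 2 - 2 * p.1 * p.2.1 * p.2.2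

lemma EE_inv (γ : Equiv.Perm (ℝ × ℝ × ℝ)) (h : γ ∈ Gamma2) : ∀ p, EE (γ p) = EE p := by
  unfold Gamma2 at h
  induction h using Subgroup.closure_induction with
  | mem g hg =>
    rintro ⟨x, y, z⟩
    rcases hg with rfl | rfl
    · simp only [EE, sigma1, Equiv.coe_fn_mk]; ring
    · simp only [EE, sigma2, Equiv.coe_fn_mk]; ring
  | one => intro p; rfl
  | mul g h _ _ hg hh => intro p; rw [Equiv.Perm.mul_apply, hg, hh]
  | inv g _ hg => intro p; rw [← hg (g⁻¹ p)]; simp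

lemma s2_step (p : ℝ × ℝ × ℝ) (n : ℤ) : (sigma2 ^ (n+1)) p = sigma2 ((sigma2 ^ n) p) := by
  rw [add_comm, zpow_add, zpow_one, Equiv.Perm.mul_apply]

lemma s1_step (p : ℝ × ℝ × ℝ) (n : ℤ) : (sigma1 ^ (n+1)) p = sigma1 ((sigma1 ^ n) p) := by
  rw [add_comm, zpow_add, zpow_one, Equiv.Perm.mul_apply]

lemma s2_fst (p : ℝ × ℝ × ℝ) (n : ℤ) : ((sigma2 ^ n) p).1 = p.1 := by
  induction n using Int.induction_on with
  | zero => rfl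
  | succ i ih => rw [s2_step, ← ih]; rfl
  | pred i ih =>
    have := s2_step p (-i - 1)
    rw [sub_add_cancel] at this
    rw [← ih, this]; rfl

lemma s1_snd (p : ℝ × ℝ × ℝ) (n : ℤ) : ((sigma1 ^ n) p).2.1 = p.2.1 := by
  induction n using Int.induction_on with
  | zero => rfl
  | succ i ih => rw [s1_step, ← ih]; rfl
  | pred i ih =>
    have := s1_step p (-i - 1)
    rw [sub_add_cancel] at this
    rw [← ih, this]; rfl

lemma step2 (p : ℝ × ℝ × ℝ) (hE : 1 < EE p) (hx : |p.1| ≤ 1)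
    (hb : ∀ n : ℤ, |((sigma2 ^ n) p).2.1| ≤ 1) :
    ∃ n : ℤ, EE p * p.1 ^ 2 ≤ ((sigma2 ^ n) p).2.1 ^ 2 := by
  refine seq_growth p.1 (EE p) (fun n => ((sigma2 ^ n) p).2.1) (fun n => ?_) hx hE hb ?_
  · have h2 := s2_step p (n-1)
    rw [sub_add_cancel] at h2
    have h3 : ((sigma2 ^ n) p).2.2 = ((sigma2 ^ (n-1)) p).2.1 := by rw [h2]; rfl
    simp only [s2_step]
    rw [← h3, ← s2_fst p n]; rfl
  · simp only [zpow_zero, zpow_one, Equiv.Perm.one_apply, EE, sigma2, Equiv.coe_fn_mk]; ring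

lemma step1 (p : ℝ × ℝ × ℝ) (hE : 1 < EE p) (hx : |p.2.1| ≤ 1)
    (hb : ∀ n : ℤ, |((sigma1 ^ n) p).1| ≤ 1) :
    ∃ n : ℤ, EE p * p.2.1 ^ 2 ≤ ((sigma1 ^ n) p).1 ^ 2 := by
  refine seq_growth p.2.1 (EE p) (fun n => ((sigma1 ^ n) p).1) (fun n => ?_) hx hE hb ?_
  · have h2 := s1_step p (n-1)
    rw [sub_add_cancel] at h2
    have h3 : ((sigma1 ^ n) p).2.2 =
        2 * p.2.1 * ((sigma1 ^ n) p).1 - ((sigma1 ^ (n-1)) p).1 := by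
      rw [h2, ← s1_snd p (n-1)]; rfl
    simp only [s1_step]
    rw [← h3]; rfl
  · simp only [zpow_zero, zpow_one, Equiv.Perm.one_apply, EE, sigma1, Equiv.coe_fn_mk]; ring

theorem stmt7 (a b c : ℝ)
    (hadm : ¬ (a = 0 ∧ b = 0) ∧ ¬ (a = 0 ∧ c = 0) ∧ ¬ (b = 0 ∧ c = 0))
    (hE : a ^ 2 + b ^ 2 + c ^ 2 - 2 * a * b * c > 1)
    (ha : |a| ≤ 1) (hb : |b| ≤ 1) (hc : |c| ≤ 1) :
    ∃ γ ∈ Gamma2,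
      1 < |(γ (a, b, c)).1| ∨ 1 < |(γ (a, b, c)).2.1| ∨ 1 < |(γ (a, b, c)).2.2| := by
  by_contra hcon
  push Not at hcon
  have m1 : sigma1 ∈ Gamma2 := Subgroup.subset_closure (by simp)
  have m2 : sigma2 ∈ Gamma2 := Subgroup.subset_closure (by simp)
  set p : ℝ × ℝ × ℝ := (a, b, c) with hp
  have hEp : 1 < EE p := hE
  have A : ∀ γ ∈ Gamma2, ∃ δ ∈ Gamma2, EE p * (γ p).1 ^ 2 ≤ (δ p).2.1 ^ 2 := by
    intro γ hγ
    have hm : ∀ n : ℤ, sigma2 ^ n * γ ∈ Gamma2 :=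
      fun n => Gamma2.mul_mem (Gamma2.zpow_mem m2 n) hγ
    obtain ⟨n, hn⟩ := step2 (γ p) (by rw [EE_inv γ hγ]; exact hEp) (hcon γ hγ).1
      (fun n => (hcon _ (hm n)).2.1)
    rw [EE_inv γ hγ] at hn
    exact ⟨_, hm n, hn⟩
  have B : ∀ γ ∈ Gamma2, ∃ δ ∈ Gamma2, EE p * (γ p).2.1 ^ 2 ≤ (δ p).1 ^ 2 := by
    intro γ hγ
    have hm : ∀ n : ℤ, sigma1 ^ n * γ ∈ Gamma2 :=
      fun n => Gamma2.mul_mem (Gamma2.zpow_mem m1 n) hγ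
    obtain ⟨n, hn⟩ := step1 (γ p) (by rw [EE_inv γ hγ]; exact hEp) (hcon γ hγ).2.1
      (fun n => (hcon _ (hm n)).1)
    rw [EE_inv γ hγ] at hn
    exact ⟨_, hm n, hn⟩
  have start : ∃ γ ∈ Gamma2, 0 < (γ p).1 ^ 2 := by
    by_cases h0 : a = 0
    · have hb0 : b ≠ 0 := fun h => hadm.1 ⟨h0, h⟩
      obtain ⟨δ, hδ, h⟩ := B 1 Gamma2.one_mem
      have h1 : 0 < b ^ 2 := by positivity
      have h2 : EE p * b ^ 2 ≤ (δ p).1 ^ 2 := h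
      exact ⟨δ, hδ, by nlinarith⟩
    · exact ⟨1, Gamma2.one_mem, by show 0 < a ^ 2; positivity⟩
  obtain ⟨γ, hγ, hpos⟩ := start
  have grow : ∀ k : ℕ, ∃ δ ∈ Gamma2, EE p ^ k * (γ p).1 ^ 2 ≤ (δ p).1 ^ 2 := by
    intro k
    induction k with
    | zero => exact ⟨γ, hγ, by simp⟩
    | succ k ih =>
      obtain ⟨δ, hδ, h⟩ := ih
      obtain ⟨δ₁, hδ₁, h₁⟩ := A δ hδ
      obtain ⟨δ₂, hδ₂, h₂⟩ := B δ₁ hδ₁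
      refine ⟨δ₂, hδ₂, ?_⟩
      rw [pow_succ]
      have := sq_nonneg (δ₁ p).2.1
      nlinarith
  obtain ⟨k, hk⟩ := pow_unbounded_of_one_lt (1 / (γ p).1 ^ 2) hEp
  rw [div_lt_iff₀ hpos] at hk
  obtain ⟨δ, hδ, h⟩ := grow k
  have := (sq_le_one_iff_abs_le_one _).2 (hcon δ hδ).1
  linarith

end
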